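/- arXiv:2110.11928 — 2 statements merged into one kernel-verified Lean document; each statement's English description precedes it below -/
import Mathlib

section
/- Fix n ∈ ℕ. The map φ : E_n → E_n^i sending h + π_n(L) to the thread (h + H_{n,m})_{m>n} is a well-defined group homomorphism, and if ⋂_{m>n} H_{n,m} ⊆ π_n(L) (as the paper derives from the description of the inverse limit of the nested subgroups H_{n,m} under inclusion), then φ is injective. -/
variable {H : ℕ → Type*} [∀ i, AddCommGroup (H i)]

/-- The composite bonding homomorphism `q_{n,n+k} = f_n ∘ ⋯ ∘ f_{n+k-1} : H_{n+k} → H_n`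
of an inverse sequence of abelian groups `(H_n, f_n)`. -/
def bondingMap (f : ∀ i, H (i + 1) →+ H i) (n : ℕ) : ∀ k : ℕ, H (n + k) →+ H n
  | 0 => AddMonoidHom.id (H n)
  | (k + 1) => (bondingMap f n k).comp (f (n + k))

/-- The inverse limit `L` of the inverse sequence `(H_n, f_n)`: the subgroup of `∏ n, H n`
consisting of the threads `s` with `f n (s (n+1)) = s n` for all `n`. -/
def inverseLimit (f : ∀ i, H (i + 1) →+ H i) : AddSubgroup (∀ i, H i) where
  carrier := {s | ∀ i, f i (s (i + 1)) = s i}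
  zero_mem' := fun i => by simp
  add_mem' := fun {a b} ha hb i => by simp [ha i, hb i]
  neg_mem' := fun {a} ha i => by simp [ha i]

/-- `π_n(L)`, the image of the inverse limit under the `n`-th projection. -/
def projImage (f : ∀ i, H (i + 1) →+ H i) (n : ℕ) : AddSubgroup (H n) :=
  AddSubgroup.map (Pi.evalAddMonoidHom H n) (inverseLimit f)

/-- The `(n, n+1+k)`-th inverse persistent group `H_{n,n+1+k} = q_{n,n+1+k}(H_{n+1+k})`. -/
def persistentGroup (f : ∀ i, H (i + 1) →+ H i) (n k : ℕ) : AddSubgroup (H n) :=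
  (bondingMap f n (k + 1)).range

/-- The homomorphism `g : E_{n,n+2+k} → E_{n,n+1+k}` between inverse persistent errors,
induced by the inclusion `H_{n,n+2+k} ⊆ H_{n,n+1+k}`. -/
def errorMap (f : ∀ i, H (i + 1) →+ H i) (n k : ℕ) :
    (H n ⧸ persistentGroup f n (k + 1)) →+ (H n ⧸ persistentGroup f n k) :=
  QuotientAddGroup.map _ _ (AddMonoidHom.id (H n)) (by
    rintro x ⟨y, rfl⟩
    exact ⟨f (n + (k + 1)) y, rfl⟩)

/-- The inductive `n`-error `E_n^i`: the inverse limit of the sequence of inverse persistent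
errors `E_{n,m}` (`m > n`) under the natural maps. -/
def inductiveError (f : ∀ i, H (i + 1) →+ H i) (n : ℕ) :
    AddSubgroup (∀ k : ℕ, H n ⧸ persistentGroup f n k) where
  carrier := {e | ∀ k, errorMap f n k (e (k + 1)) = e k}
  zero_mem' := fun k => by simp
  add_mem' := fun {a b} ha hb k => by simp [ha k, hb k]
  neg_mem' := fun {a} ha k => by simp [ha k]

theorem bondingMap_apply_of_mem_inverseLimit (f : ∀ i, H (i + 1) →+ H i) (n : ℕ)
    {s : ∀ i, H i} (hs : s ∈ inverseLimit f) (k : ℕ) :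
    bondingMap f n k (s (n + k)) = s n := by
  induction k with
  | zero => rfl
  | succ k ih => exact (congrArg (bondingMap f n k) (hs (n + k))).trans ih

theorem projImage_le_persistentGroup (f : ∀ i, H (i + 1) →+ H i) (n k : ℕ) :
    projImage f n ≤ persistentGroup f n k := by
  rintro _ ⟨s, hs, rfl⟩
  exact ⟨s (n + (k + 1)), bondingMap_apply_of_mem_inverseLimit f n hs (k + 1)⟩

/-- The homomorphism `H_n → E_n^i` sending `h` to the thread `(h + H_{n,m})_{m>n}`. -/
def toInductiveError (f : ∀ i, H (i + 1) →+ H i) (n : ℕ) : H n →+ inductiveError f n :=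
  (AddMonoidHom.mk' (fun h k => (QuotientAddGroup.mk h : H n ⧸ persistentGroup f n k))
    fun _ _ => rfl).codRestrict (inductiveError f n) fun _ _ => rfl

theorem ker_toInductiveError (f : ∀ i, H (i + 1) →+ H i) (n : ℕ) :
    (toInductiveError f n).ker = ⨅ k : ℕ, persistentGroup f n k := by
  ext h
  rw [AddMonoidHom.mem_ker, AddSubgroup.mem_iInf, Subtype.ext_iff, funext_iff]
  exact forall_congr' fun k => QuotientAddGroup.eq_zero_iff h

/-- The map `φ : E_n → E_n^i`, `h + π_n(L) ↦ (h + H_{n,m})_{m>n}`, is a well-defined group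
homomorphism, and it is injective provided `⋂_{m>n} H_{n,m} ⊆ π_n(L)`. -/
theorem realError_to_inductiveError (f : ∀ i, H (i + 1) →+ H i) (n : ℕ) :
    ∃ φ : (H n ⧸ projImage f n) →+ inductiveError f n,
      (∀ h : H n, ∀ k : ℕ,
        ((φ ((QuotientAddGroup.mk h : H n ⧸ projImage f n))) :
            ∀ k : ℕ, H n ⧸ persistentGroup f n k) k =
          (QuotientAddGroup.mk h : H n ⧸ persistentGroup f n k)) ∧
      ((⨅ k : ℕ, persistentGroup f n k) ≤ projImage f n → Function.Injective φ) := by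
  have hle : projImage f n ≤ (toInductiveError f n).ker := by
    rw [ker_toInductiveError]
    exact le_iInf (projImage_le_persistentGroup f n)
  refine ⟨QuotientAddGroup.lift (projImage f n) (toInductiveError f n) hle,
    fun _ _ => rfl, fun hker => ?_⟩
  rw [injective_iff_map_eq_zero]
  rintro ⟨h⟩ hh
  refine (QuotientAddGroup.eq_zero_iff h).2 (hker ?_)
  rw [← ker_toInductiveError]
  exact hh
end

section
/- If an inverse sequence of abelian groups (H_n, f_n) has the Mittag-Leffler property, then for every n ∈ ℕ the natural homomorphism φ : E_n → E_n^i, h + π_n(L) ↦ (h + H_{n,m})_{m>n}, is a group isomorphism; in particular the inductive n-error coincides with the n-th real error, E_n^i ≅ E_n. -/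
variable {H : ℕ → Type*} [∀ i, AddCommGroup (H i)]

/-- The bonding maps commute with transport along an equality of indices. -/
theorem bonding_cast (f : ∀ i, H (i + 1) →+ H i) {a b : ℕ} (e : a = b)
    (e' : a + 1 = b + 1) (x : H (a + 1)) :
    f b (cast (congrArg H e') x) = cast (congrArg H e) (f a x) := by
  subst e
  rfl

theorem bondingMap_succ_cast (f : ∀ i, H (i + 1) →+ H i) (n k : ℕ)
    (e : n + 1 + k = n + (k + 1)) (x : H (n + 1 + k)) :
    bondingMap f n (k + 1) (cast (congrArg H e) x) = f n (bondingMap f (n + 1) k x) := by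
  induction k with
  | zero => rfl
  | succ k ih =>
    have e₁ : n + 1 + k = n + (k + 1) := by omega
    change bondingMap f n (k + 1) (f (n + (k + 1)) (cast (congrArg H e) x)) =
      f n (bondingMap f (n + 1) k (f (n + 1 + k) x))
    rw [← ih e₁, ← bonding_cast f e₁ e]

theorem range_bondingMap_succ (f : ∀ i, H (i + 1) →+ H i) (n k : ℕ) :
    (bondingMap f n (k + 1)).range = (bondingMap f (n + 1) k).range.map (f n) := by
  have e : n + 1 + k = n + (k + 1) := by omega
  ext h
  constructor
  · rintro ⟨y, rfl⟩
    refine ⟨_, ⟨cast (congrArg H e.symm) y, rfl⟩, ?_⟩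
    rw [← bondingMap_succ_cast f n k e, cast_cast, cast_eq]
  · rintro ⟨_, ⟨x, rfl⟩, rfl⟩
    exact ⟨cast (congrArg H e) x, bondingMap_succ_cast f n k e x⟩

theorem bondingMap_apply_of_compatible (f : ∀ i, H (i + 1) →+ H i) (n : ℕ)
    (t : ∀ k, H (n + k)) (ht : ∀ k, f (n + k) (t (k + 1)) = t k) (k : ℕ) :
    bondingMap f n k (t k) = t 0 := by
  induction k with
  | zero => rfl
  | succ k ih =>
    change bondingMap f n k (f (n + k) (t (k + 1))) = t 0
    rw [ht, ih]

/-- A compatible family indexed from `n` on extends to a thread. -/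
theorem mem_projImage_of_compatible (f : ∀ i, H (i + 1) →+ H i) (n : ℕ)
    (t : ∀ k, H (n + k)) (ht : ∀ k, f (n + k) (t (k + 1)) = t k) :
    t 0 ∈ projImage f n := by
  refine ⟨fun i => bondingMap f i n (cast (congrArg H (Nat.add_comm n i)) (t i)), ?_, ?_⟩
  · intro i
    have e : i + 1 + n = i + (n + 1) := by omega
    rw [← bondingMap_succ_cast f i n e, cast_cast]
    change bondingMap f i n (f (i + n) _) = bondingMap f i n (cast _ (t i))
    rw [← ht i, ← bonding_cast f (Nat.add_comm n i) (by omega)]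
  · exact bondingMap_apply_of_compatible f n t ht n

/-- The subgroup of elements of `H n` that lift arbitrarily far. -/
def stableImage (f : ∀ i, H (i + 1) →+ H i) (n : ℕ) : AddSubgroup (H n) :=
  ⨅ k, (bondingMap f n k).range

theorem mem_stableImage (f : ∀ i, H (i + 1) →+ H i) (n : ℕ) (h : H n) :
    h ∈ stableImage f n ↔ ∀ k, h ∈ (bondingMap f n k).range :=
  AddSubgroup.mem_iInf

theorem range_bondingMap_antitone (f : ∀ i, H (i + 1) →+ H i) (n : ℕ) :
    Antitone fun k => (bondingMap f n k).range := by
  refine antitone_nat_of_succ_le fun k => ?_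
  rintro _ ⟨y, rfl⟩
  exact ⟨f (n + k) y, rfl⟩

theorem projImage_le_stableImage (f : ∀ i, H (i + 1) →+ H i) (n : ℕ) :
    projImage f n ≤ stableImage f n := by
  rintro _ ⟨s, hs, rfl⟩
  exact (mem_stableImage f n _).2 fun k =>
    ⟨s (n + k), bondingMap_apply_of_compatible f n (fun k => s (n + k)) (fun k => hs (n + k)) k⟩

theorem exists_stableImage_lift (f : ∀ i, H (i + 1) →+ H i)
    (hML : ∀ n : ℕ, ∃ k : ℕ, ∀ j : ℕ,
      (bondingMap f n (k + j)).range = (bondingMap f n k).range)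
    (n : ℕ) (h : stableImage f n) : ∃ x : stableImage f (n + 1), f n x = h := by
  obtain ⟨K, hK⟩ := hML (n + 1)
  have hh := (mem_stableImage f n _).1 h.2 (K + 1)
  rw [range_bondingMap_succ] at hh
  obtain ⟨x, hx, hxh⟩ := hh
  refine ⟨⟨x, (mem_stableImage f _ _).2 fun k => ?_⟩, hxh⟩
  exact range_bondingMap_antitone f (n + 1) (Nat.le_add_left k K) ((hK k).ge hx)

/-- For a Mittag-Leffler sequence, the elements that lift arbitrarily far are the
coordinates of threads. -/
theorem projImage_eq_stableImage (f : ∀ i, H (i + 1) →+ H i)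
    (hML : ∀ n : ℕ, ∃ k : ℕ, ∀ j : ℕ,
      (bondingMap f n (k + j)).range = (bondingMap f n k).range) (n : ℕ) :
    projImage f n = stableImage f n := by
  refine le_antisymm (projImage_le_stableImage f n) fun h hh => ?_
  choose lift hlift using exists_stableImage_lift f hML
  let t : ∀ k, stableImage f (n + k) := fun k =>
    Nat.rec (motive := fun k => stableImage f (n + k)) ⟨h, hh⟩ (fun k x => lift (n + k) x) k
  exact mem_projImage_of_compatible f n (fun k => (t k : H (n + k)))
    fun k => hlift (n + k) (t k)

theorem inductiveError_apply_eq_mk (f : ∀ i, H (i + 1) →+ H i) (n : ℕ)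
    (e : inductiveError f n) (h : H n) (k j : ℕ)
    (he : e.1 (k + j) = QuotientAddGroup.mk h) : e.1 k = QuotientAddGroup.mk h := by
  induction j with
  | zero => exact he
  | succ j ih =>
    refine ih ?_
    rw [← e.2 (k + j)]
    exact congrArg (errorMap f n (k + j)) he

/-- The natural homomorphism from the real error to the inductive error. -/
def realErrorToInductiveError (f : ∀ i, H (i + 1) →+ H i) (n : ℕ) :
    (H n ⧸ projImage f n) →+ inductiveError f n :=
  AddMonoidHom.codRestrict
    (AddMonoidHom.pi fun k => QuotientAddGroup.map (projImage f n) (persistentGroup f n k)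
      (AddMonoidHom.id (H n)) (projImage_le_persistentGroup f n k))
    (inductiveError f n) (by
      intro x
      induction x using QuotientAddGroup.induction_on
      exact fun k => rfl)

theorem realErrorToInductiveError_mk (f : ∀ i, H (i + 1) →+ H i) (n : ℕ) (h : H n) (k : ℕ) :
    (realErrorToInductiveError f n (QuotientAddGroup.mk h)).1 k = QuotientAddGroup.mk h :=
  rfl

theorem realErrorToInductiveError_injective (f : ∀ i, H (i + 1) →+ H i)
    (hML : ∀ n : ℕ, ∃ k : ℕ, ∀ j : ℕ,
      (bondingMap f n (k + j)).range = (bondingMap f n k).range) (n : ℕ) :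
    Function.Injective (realErrorToInductiveError f n) := by
  rw [injective_iff_map_eq_zero]
  intro x hx
  induction x using QuotientAddGroup.induction_on with
  | H h =>
    rw [QuotientAddGroup.eq_zero_iff, projImage_eq_stableImage f hML, mem_stableImage]
    intro k
    have hk : (QuotientAddGroup.mk h : H n ⧸ persistentGroup f n k) = 0 := by
      rw [← realErrorToInductiveError_mk, hx]
      rfl
    exact range_bondingMap_antitone f n k.le_succ ((QuotientAddGroup.eq_zero_iff h).1 hk)

theorem realErrorToInductiveError_surjective (f : ∀ i, H (i + 1) →+ H i) (n : ℕ)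
    (hML : ∃ k : ℕ, ∀ j : ℕ,
      (bondingMap f n (k + j)).range = (bondingMap f n k).range) :
    Function.Surjective (realErrorToInductiveError f n) := by
  intro e
  obtain ⟨K, hK⟩ := hML
  obtain ⟨h, hh⟩ := QuotientAddGroup.mk_surjective (e.1 K)
  refine ⟨QuotientAddGroup.mk h, Subtype.ext (funext fun j => ?_)⟩
  rw [realErrorToInductiveError_mk]
  refine (inductiveError_apply_eq_mk f n e h j K ?_).symm
  rw [Nat.add_comm j K]
  obtain ⟨h', hh'⟩ := QuotientAddGroup.mk_surjective (e.1 (K + j))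
  have hmk : (QuotientAddGroup.mk h' : H n ⧸ persistentGroup f n K) = QuotientAddGroup.mk h := by
    rw [hh, inductiveError_apply_eq_mk f n e h' K j hh'.symm]
  have hstable : persistentGroup f n (K + j) = persistentGroup f n K :=
    (hK (j + 1)).trans (hK 1).symm
  rw [← hh', QuotientAddGroup.eq, hstable]
  exact QuotientAddGroup.eq.1 hmk

/-- For a Mittag-Leffler inverse sequence of abelian groups, the natural homomorphism
`φ : E_n → E_n^i`, `h + π_n(L) ↦ (h + H_{n,m})_{m>n}`, is a group isomorphism; in particular
the inductive `n`-error coincides with the `n`-th real error. -/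
theorem realError_equiv_inductiveError (f : ∀ i, H (i + 1) →+ H i)
    (hML : ∀ n : ℕ, ∃ k : ℕ, ∀ j : ℕ,
      (bondingMap f n (k + j)).range = (bondingMap f n k).range) :
    ∀ n : ℕ, ∃ φ : (H n ⧸ projImage f n) →+ inductiveError f n,
      (∀ h : H n, ∀ k : ℕ,
        ((φ ((QuotientAddGroup.mk h : H n ⧸ projImage f n))) :
            ∀ k : ℕ, H n ⧸ persistentGroup f n k) k =
          (QuotientAddGroup.mk h : H n ⧸ persistentGroup f n k)) ∧
      Function.Bijective φ := by
  exact fun n => ⟨realErrorToInductiveError f n, realErrorToInductiveError_mk f n,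
    realErrorToInductiveError_injective f hML n, realErrorToInductiveError_surjective f n (hML n)⟩
end
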